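/- Let A_1, A_2, …, A_{10} be points on a circle in the Euclidean plane (all ten points equidistant from some center O, at a common positive radius), with A_j ≠ A_{j+1} for all j (indices mod 10). Write s_j = A_{j+1} − A_j for the side vectors (indices mod 10, so s_{10} = A_1 − A_{10}). If s_j is parallel to s_{j+5} (the vectors are linearly dependent) for j = 1, 2, 3, 4, then s_5 is parallel to s_{10}. -/

import Mathlib

open Real

open ComplexConjugate in
/-- Chords `ab` and `cd` of a circle centred at the origin of `ℂ` are parallel iff `ab = cd`. -/
lemma chord_parallel_iff_mul_eq {a b c d : ℂ} {R : ℝ} (hR : R ≠ 0)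
    (ha : Complex.normSq a = R) (hb : Complex.normSq b = R)
    (hc : Complex.normSq c = R) (hd : Complex.normSq d = R) (hab : a ≠ b) (hcd : c ≠ d) :
    (conj (b - a) * (d - c)).im = 0 ↔ a * b = c * d := by
  have hRC : (R : ℂ) ≠ 0 := Complex.ofReal_ne_zero.mpr hR
  have key {z : ℂ} (hz : Complex.normSq z = R) : z ≠ 0 ∧ conj z = R / z := by
    have hz0 : z ≠ 0 := by
      rintro rfl
      exact hR (by simpa using hz.symm)
    refine ⟨hz0, ?_⟩
    rw [eq_div_iff hz0, mul_comm, Complex.mul_conj, hz]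
  obtain ⟨ha0, ha'⟩ := key ha
  obtain ⟨hb0, hb'⟩ := key hb
  obtain ⟨hc0, hc'⟩ := key hc
  obtain ⟨hd0, hd'⟩ := key hd
  rw [← Complex.conj_eq_iff_im]
  simp only [map_mul, map_sub, Complex.conj_conj]
  rw [ha', hb', hc', hd']
  have hdiff : (b - a) * (R / d - R / c) - (R / b - R / a) * (d - c)
      = R * (b - a) * (d - c) * (c * d - a * b) / (a * b * c * d) := by
    field_simp
    ring
  rw [← sub_eq_zero, hdiff]
  simp [ha0, hb0, hc0, hd0, hRC, sub_ne_zero.mpr hab.symm, sub_ne_zero.mpr hcd.symm,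
    sub_eq_zero, eq_comm]

lemma not_linearIndependent_pair_iff_cross_eq_zero (u v : EuclideanSpace ℝ (Fin 2)) :
    ¬ LinearIndependent ℝ ![u, v] ↔ u 0 * v 1 - u 1 * v 0 = 0 := by
  rw [LinearIndependent.pair_iff]
  constructor
  · intro h
    by_contra hne
    refine h fun s t hst => ?_
    have e₀ : s * u 0 + t * v 0 = 0 := by simpa using congrArg (· 0) hst
    have e₁ : s * u 1 + t * v 1 = 0 := by simpa using congrArg (· 1) hst
    constructor
    · refine (mul_eq_zero.mp ?_).resolve_right hne
      linear_combination v 1 * e₀ - v 0 * e₁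
    · refine (mul_eq_zero.mp ?_).resolve_right hne
      linear_combination u 0 * e₁ - u 1 * e₀
  · intro hcross h
    have h₀ := h (v 0) (-u 0) (by
      ext i
      fin_cases i
      · simp; ring
      · simp; linear_combination -hcross)
    have h₁ := h (v 1) (-u 1) (by
      ext i
      fin_cases i
      · simp; linear_combination hcross
      · simp; ring)
    have hu : u = 0 := by
      ext i
      fin_cases i
      · simpa using h₀.2
      · simpa using h₁.2
    exact one_ne_zero (h 1 0 (by simp [hu])).1

/-- The complex number representing the position of `A` relative to `O`. -/
def complexOffset (O A : EuclideanSpace ℝ (Fin 2)) : ℂ := ⟨A 0 - O 0, A 1 - O 1⟩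

lemma normSq_complexOffset {O A : EuclideanSpace ℝ (Fin 2)} {r : ℝ} (h : dist A O = r) :
    Complex.normSq (complexOffset O A) = r ^ 2 := by
  rw [← h, EuclideanSpace.dist_eq, Real.sq_sqrt (by positivity)]
  simp [complexOffset, Complex.normSq_apply, Real.dist_eq, sq_abs]
  ring

lemma complexOffset_injective (O : EuclideanSpace ℝ (Fin 2)) :
    Function.Injective (complexOffset O) := by
  intro A B h
  ext i
  fin_cases i
  · simpa [complexOffset] using congrArg Complex.re h
  · simpa [complexOffset] using congrArg Complex.im h

/-- Chords `AB` and `CD` of a circle are parallel iff the products of the complex offsets of their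
endpoints from the centre agree. -/
lemma not_linearIndependent_chords_iff {O A B C D : EuclideanSpace ℝ (Fin 2)} {r : ℝ} (hr : 0 < r)
    (hA : dist A O = r) (hB : dist B O = r) (hC : dist C O = r) (hD : dist D O = r)
    (hAB : A ≠ B) (hCD : C ≠ D) :
    ¬ LinearIndependent ℝ ![B - A, D - C] ↔
      complexOffset O A * complexOffset O B = complexOffset O C * complexOffset O D := by
  rw [not_linearIndependent_pair_iff_cross_eq_zero,
    ← chord_parallel_iff_mul_eq (pow_ne_zero 2 hr.ne') (normSq_complexOffset hA)
      (normSq_complexOffset hB) (normSq_complexOffset hC) (normSq_complexOffset hD)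
      ((complexOffset_injective O).ne hAB) ((complexOffset_injective O).ne hCD)]
  refine Eq.congr_left ?_
  simp [complexOffset]
  ring

/-- **Cyclic decagon with four pairs of opposite sides parallel.** If
`A₁, …, A₁₀` lie on a circle with center `O` and radius `r > 0`, with
consecutive vertices distinct (indices mod 10), and the side pairs
`(s₁,s₆), (s₂,s₇), (s₃,s₈), (s₄,s₉)` are parallel, then `s₅ ∥ s₁₀`. -/
theorem cyclic_decagon_parallel
    (O A₁ A₂ A₃ A₄ A₅ A₆ A₇ A₈ A₉ A₁₀ : EuclideanSpace ℝ (Fin 2))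
    (r : ℝ) (hr : 0 < r)
    (h₁ : dist A₁ O = r) (h₂ : dist A₂ O = r) (h₃ : dist A₃ O = r)
    (h₄ : dist A₄ O = r) (h₅ : dist A₅ O = r) (h₆ : dist A₆ O = r)
    (h₇ : dist A₇ O = r) (h₈ : dist A₈ O = r) (h₉ : dist A₉ O = r)
    (h₁₀ : dist A₁₀ O = r)
    (n₁ : A₁ ≠ A₂) (n₂ : A₂ ≠ A₃) (n₃ : A₃ ≠ A₄) (n₄ : A₄ ≠ A₅)
    (n₅ : A₅ ≠ A₆) (n₆ : A₆ ≠ A₇) (n₇ : A₇ ≠ A₈) (n₈ : A₈ ≠ A₉)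
    (n₉ : A₉ ≠ A₁₀) (n₁₀ : A₁₀ ≠ A₁)
    (p₁ : ¬ LinearIndependent ℝ ![A₂ - A₁, A₇ - A₆])
    (p₂ : ¬ LinearIndependent ℝ ![A₃ - A₂, A₈ - A₇])
    (p₃ : ¬ LinearIndependent ℝ ![A₄ - A₃, A₉ - A₈])
    (p₄ : ¬ LinearIndependent ℝ ![A₅ - A₄, A₁₀ - A₉]) :
    ¬ LinearIndependent ℝ ![A₆ - A₅, A₁ - A₁₀] := by
  rw [not_linearIndependent_chords_iff hr h₁ h₂ h₆ h₇ n₁ n₆] at p₁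
  rw [not_linearIndependent_chords_iff hr h₂ h₃ h₇ h₈ n₂ n₇] at p₂
  rw [not_linearIndependent_chords_iff hr h₃ h₄ h₈ h₉ n₃ n₈] at p₃
  rw [not_linearIndependent_chords_iff hr h₄ h₅ h₉ h₁₀ n₄ n₉] at p₄
  rw [not_linearIndependent_chords_iff hr h₅ h₆ h₁₀ h₁ n₅ n₁₀]
  have offset_ne_zero {A : EuclideanSpace ℝ (Fin 2)} (h : dist A O = r) :
      complexOffset O A ≠ 0 := by
    rw [← Complex.normSq_pos, normSq_complexOffset h]
    positivity
  generalize complexOffset O = z at *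
  have hne : z A₇ * z A₈ * z A₉ * (z A₂ * z A₃ * z A₄) ≠ 0 := by
    simp [*]
  apply mul_left_cancel₀ hne
  calc z A₇ * z A₈ * z A₉ * (z A₂ * z A₃ * z A₄) * (z A₅ * z A₆)
      = (z A₆ * z A₇) * (z A₈ * z A₉) * ((z A₂ * z A₃) * (z A₄ * z A₅)) := by ring
    _ = (z A₁ * z A₂) * (z A₃ * z A₄) * ((z A₇ * z A₈) * (z A₉ * z A₁₀)) := by
      rw [p₁, p₂, p₃, p₄]
    _ = z A₇ * z A₈ * z A₉ * (z A₂ * z A₃ * z A₄) * (z A₁₀ * z A₁) := by ring
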